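/- arXiv:2511.10299 — 2 statements merged into one kernel-verified Lean document; each statement's English description precedes it below -/
import Mathlib

section
/- Let μ be the infinite product, over j ∈ ℕ, of copies of the standard Gaussian measure N(0,1) on ℝ (a probability measure on the space of functions ℕ → ℝ). Let λ : ℕ → ℝ be a nonnegative summable sequence such that λ_j > 0 for infinitely many indices j. Then for every real p ≥ 1, the function x ↦ (∑_{j∈ℕ} λ_j x_j²)^{−p} is μ-integrable. -/
open MeasureTheory ProbabilityTheory

lemma integrable_sq_rpow_neg_mul_exp_neg_mul_sq {b q : ℝ} (hb : 0 < b) (hq : q < 1 / 2) :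
    Integrable (fun x : ℝ => (x ^ 2) ^ (-q) * Real.exp (-b * x ^ 2)) := by
  have hpos : IntegrableOn (fun x : ℝ => (x ^ 2) ^ (-q) * Real.exp (-b * x ^ 2))
      (Set.Ioi 0) := by
    refine (integrableOn_rpow_mul_exp_neg_mul_sq hb (s := -(2 * q)) (by linarith)).congr_fun
      (fun x hx => ?_) measurableSet_Ioi
    have hx' : (0 : ℝ) ≤ x := le_of_lt hx
    simp only
    rw [← Real.rpow_natCast x 2, ← Real.rpow_mul hx']
    push_cast
    ring_nf
  rw [← integrableOn_univ, ← Set.Iio_union_Ici (a := (0 : ℝ)), integrableOn_union,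
    integrableOn_Ici_iff_integrableOn_Ioi]
  refine ⟨?_, hpos⟩
  rw [← (Measure.measurePreserving_neg (volume : Measure ℝ)).integrableOn_comp_preimage
      (Homeomorph.neg ℝ).measurableEmbedding]
  simpa only [Function.comp_def, neg_sq, Set.neg_preimage, Set.neg_Iio, neg_zero] using hpos

lemma integrable_const_mul_sq_rpow_neg_gaussianReal {c q : ℝ} (hc : 0 ≤ c) (hq : q < 1 / 2) :
    Integrable (fun x : ℝ => (c * x ^ 2) ^ (-q)) (gaussianReal 0 1) := by
  rw [gaussianReal_of_var_ne_zero 0 one_ne_zero,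
    integrable_withDensity_iff_integrable_smul' (measurable_gaussianPDF 0 1)
      (ae_of_all _ fun _ => gaussianPDF_lt_top)]
  refine ((integrable_sq_rpow_neg_mul_exp_neg_mul_sq (b := 1 / 2) (by norm_num) hq).const_mul
    ((√(2 * Real.pi))⁻¹ * c ^ (-q))).congr (ae_of_all _ fun x => ?_)
  simp only [toReal_gaussianPDF, gaussianPDFReal, smul_eq_mul, Real.mul_rpow hc (sq_nonneg x),
    NNReal.coe_one, mul_one, sub_zero]
  rw [show -(1 / 2) * x ^ 2 = -x ^ 2 / 2 by ring]
  ring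

lemma measurable_tsum_of_nonneg {α : Type*} [MeasurableSpace α] {f : ℕ → α → ℝ}
    (hf : ∀ j, Measurable (f j)) (hf_nonneg : ∀ j x, 0 ≤ f j x) :
    Measurable (fun x => ∑' j, f j x) := by
  have h : (fun x => ∑' j, f j x) = fun x => (∑' j, ENNReal.ofReal (f j x)).toReal := by
    funext x
    rw [ENNReal.tsum_toReal_eq fun _ => ENNReal.ofReal_ne_top]
    simp only [ENNReal.toReal_ofReal (hf_nonneg _ x)]
  rw [h]
  exact (Measurable.tsum fun j => (hf j).ennreal_ofReal).ennreal_toReal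

/-- A negative power of the sum of a nonnegative series is bounded, via the AM-GM inequality, by a
product of negative powers of finitely many positive terms. It holds for a divergent series too,
because its `tsum` is zero and `0 ^ (-p) = 0`. -/
lemma tsum_rpow_neg_le_prod_rpow_neg {a : ℕ → ℝ} (ha : ∀ j, 0 ≤ a j) {s : Finset ℕ}
    (hs : s.Nonempty) (has : ∀ j ∈ s, 0 < a j) {p : ℝ} (hp : 0 < p) :
    (∑' j, a j) ^ (-p) ≤ ∏ j ∈ s, a j ^ (-(p / s.card)) := by
  have hprod : 0 ≤ ∏ j ∈ s, a j ^ (-(p / s.card)) :=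
    Finset.prod_nonneg fun j _ => Real.rpow_nonneg (ha j) _
  by_cases hsum : Summable a
  · have hcard : (1 : ℝ) ≤ s.card := by exact_mod_cast hs.card_pos
    have hinv : ((s.card : ℝ))⁻¹ ≤ 1 := inv_le_one_of_one_le₀ hcard
    have hgm : ∏ j ∈ s, a j ^ ((s.card : ℝ))⁻¹ ≤ ∑' j, a j :=
      calc ∏ j ∈ s, a j ^ ((s.card : ℝ))⁻¹
          ≤ ∑ j ∈ s, ((s.card : ℝ))⁻¹ * a j :=
            Real.geom_mean_le_arith_mean_weighted s (fun _ => ((s.card : ℝ))⁻¹) a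
              (fun _ _ => by positivity)
              (by rw [Finset.sum_const, nsmul_eq_mul]; exact mul_inv_cancel₀ (by linarith))
              (fun j _ => ha j)
        _ ≤ ∑ j ∈ s, a j := Finset.sum_le_sum fun j _ => mul_le_of_le_one_left (ha j) hinv
        _ ≤ ∑' j, a j := hsum.sum_le_tsum s fun j _ => ha j
    have hpos : 0 < ∏ j ∈ s, a j ^ ((s.card : ℝ))⁻¹ :=
      Finset.prod_pos fun j hj => Real.rpow_pos_of_pos (has j hj) _
    calc (∑' j, a j) ^ (-p)
        ≤ (∏ j ∈ s, a j ^ ((s.card : ℝ))⁻¹) ^ (-p) :=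
          Real.rpow_le_rpow_of_nonpos hpos hgm (by linarith)
      _ = ∏ j ∈ s, a j ^ (-(p / s.card)) := by
          rw [← Real.finsetProd_rpow s _ fun j _ => Real.rpow_nonneg (ha j) _]
          refine Finset.prod_congr rfl fun j _ => ?_
          rw [← Real.rpow_mul (ha j)]
          ring_nf
  · rwa [tsum_eq_zero_of_not_summable hsum, Real.zero_rpow (by linarith)]

/-- **Negative moments of an infinite weighted sum of squared Gaussians.**
Let `μ` be the infinite product, over `j ∈ ℕ`, of copies of the standard Gaussian measure
`N(0,1)` on `ℝ`: the (unique) probability measure on `ℕ → ℝ` all of whose finite-dimensional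
marginals are the corresponding finite products of standard Gaussians.  Let `λ : ℕ → ℝ` be
nonnegative and summable with `λ j > 0` for infinitely many `j`.  Then for every real
`p ≥ 1` the function `x ↦ (∑_j λ j * x j ²)^(−p)` is `μ`-integrable. -/
theorem integrable_neg_rpow_tsum_weighted_sq_gaussian
    (μ : Measure (ℕ → ℝ)) [IsProbabilityMeasure μ]
    (hμ : ∀ s : Finset ℕ,
      Measure.map (fun (x : ℕ → ℝ) (j : s) => x j) μ =
        Measure.pi (fun _ : s => gaussianReal 0 1))
    (lam : ℕ → ℝ) (hlam_nonneg : ∀ j, 0 ≤ lam j) (hlam_summable : Summable lam)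
    (hlam_inf : {j : ℕ | 0 < lam j}.Infinite)
    (p : ℝ) (hp : 1 ≤ p) :
    Integrable (fun x : ℕ → ℝ => (∑' j, lam j * (x j) ^ 2) ^ (-p)) μ := by
  obtain ⟨n, hn⟩ := exists_nat_gt (2 * p)
  obtain ⟨s, hs_pos, hs_card⟩ := hlam_inf.exists_subset_card_eq n
  have hn_pos : (0 : ℝ) < s.card := by rw [hs_card]; linarith
  have hq : p / s.card < 1 / 2 := by
    rw [div_lt_iff₀ hn_pos, hs_card]
    linarith
  have hs_nonempty : s.Nonempty := Finset.card_pos.1 (by exact_mod_cast hn_pos)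
  have hrestrict : Measurable (fun (x : ℕ → ℝ) (j : s) => x j) := by fun_prop
  have hdom : Integrable (fun x : ℕ → ℝ => ∏ j : s, (lam j * x j ^ 2) ^ (-(p / s.card))) μ := by
    have h : Integrable (fun y : s → ℝ => ∏ j : s, (lam j * y j ^ 2) ^ (-(p / s.card)))
        (Measure.map (fun (x : ℕ → ℝ) (j : s) => x j) μ) := by
      rw [hμ s]
      exact Integrable.fintype_prod
        (f := fun (j : s) (y : ℝ) => (lam j * y ^ 2) ^ (-(p / s.card)))
        fun j => integrable_const_mul_sq_rpow_neg_gaussianReal (hlam_nonneg j) hq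
    exact h.comp_measurable hrestrict
  have hne : ∀ᵐ x ∂μ, ∀ j : s, x j ≠ 0 := by
    have := nullSingletonClass_gaussianReal (μ := 0) (v := 1) one_ne_zero
    refine ae_of_ae_map (p := fun y : s → ℝ => ∀ j, y j ≠ 0) hrestrict.aemeasurable ?_
    rw [hμ s, ae_all_iff]
    exact fun j => (Measure.quasiMeasurePreserving_eval (fun _ : s => gaussianReal 0 1) j).ae
      (Measure.ae_ne _ 0)
  refine hdom.mono' ?_ ?_
  · exact ((measurable_tsum_of_nonneg (f := fun j (x : ℕ → ℝ) => lam j * x j ^ 2)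
      (fun j => by fun_prop) fun j x => mul_nonneg (hlam_nonneg j) (sq_nonneg (x j))).pow_const _).aestronglyMeasurable
  · filter_upwards [hne] with x hx
    have hterm : ∀ j, 0 ≤ lam j * x j ^ 2 := fun j => mul_nonneg (hlam_nonneg j) (sq_nonneg _)
    rw [Real.norm_of_nonneg (Real.rpow_nonneg (tsum_nonneg hterm) _),
      Finset.prod_coe_sort s fun j => (lam j * x j ^ 2) ^ (-(p / s.card))]
    refine tsum_rpow_neg_le_prod_rpow_neg hterm hs_nonempty (fun j hj => ?_) (by linarith)
    exact mul_pos (hs_pos hj) (sq_pos_of_ne_zero (hx ⟨j, hj⟩))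
end

section
/- Fix H ∈ (1/2, 1). Then for all real numbers 0 ≤ s ≤ t, ∫_{ℝ²} L̃_t(y_1, y_2) L̃_s(y_1, y_2) dy_1 dy_2 = (1/2) (t^{2H} + s^{2H} − (t − s)^{2H}) · ∫_{ℝ²} L̃_1(y_1, y_2)² dy_1 dy_2. -/
open MeasureTheory

/-- The (unnormalized) Rosenblatt kernel
`L̃_t(y₁, y₂) = ∫_0^t (u − y₁)₊^{H/2−1} (u − y₂)₊^{H/2−1} du`,
where `θ₊^α = θ^α` if `θ > 0` and `0` otherwise, and `∫_0^t := −∫_t^0` for `t < 0`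
(the interval integral convention). -/
noncomputable def rosKernel (H t y₁ y₂ : ℝ) : ℝ :=
  ∫ u in (0 : ℝ)..t,
    (if 0 < u - y₁ then (u - y₁) ^ (H / 2 - 1) else 0) *
      (if 0 < u - y₂ then (u - y₂) ^ (H / 2 - 1) else 0)

/-- The truncated power `x₊^{H/2-1}`. -/
noncomputable def rosPow (H x : ℝ) : ℝ := if 0 < x then x ^ (H / 2 - 1) else 0

lemma rosPow_nonneg (H x : ℝ) : 0 ≤ rosPow H x := by
  unfold rosPow
  split_ifs with h
  · positivity
  · exact le_rfl

@[fun_prop]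
lemma measurable_rosPow (H : ℝ) : Measurable (rosPow H) :=
  Measurable.ite measurableSet_Ioi (by fun_prop) measurable_const

lemma rosPow_mul (H : ℝ) {t : ℝ} (ht : 0 < t) (x : ℝ) :
    rosPow H (t * x) = t ^ (H / 2 - 1) * rosPow H x := by
  unfold rosPow
  by_cases h : 0 < x
  · rw [if_pos h, if_pos (mul_pos ht h), Real.mul_rpow ht.le h.le]
  · rw [if_neg h, if_neg (by rwa [mul_pos_iff_of_pos_left ht]), mul_zero]

lemma rosKernel_eq (H t y₁ y₂ : ℝ) :
    rosKernel H t y₁ y₂ = ∫ u in (0 : ℝ)..t, rosPow H (u - y₁) * rosPow H (u - y₂) := rfl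

lemma lintegral_rosPow_mul_rosPow_add_le {H : ℝ} (hH : H ∈ Set.Ioo (1 / 2 : ℝ) 1) {w : ℝ}
    (hw : 0 < w) :
    ∫⁻ x, ENNReal.ofReal (rosPow H x) * ENNReal.ofReal (rosPow H (x + w)) ≤
      ENNReal.ofReal ((1 / (H / 2) + 1 / (1 - H)) * w ^ (H - 1)) := by
  obtain ⟨h1, h2⟩ := hH
  have hsub : ∀ x, ENNReal.ofReal (rosPow H x) * ENNReal.ofReal (rosPow H (x + w)) ≤
      (Set.Ioc 0 w).indicator (fun x => ENNReal.ofReal (x ^ (H / 2 - 1) * w ^ (H / 2 - 1))) x +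
      (Set.Ioi w).indicator (fun x => ENNReal.ofReal (x ^ (H - 2))) x := by
    intro x
    rw [← ENNReal.ofReal_mul (rosPow_nonneg _ _)]
    by_cases hx : 0 < x
    · have hxw : 0 < x + w := by positivity
      simp only [rosPow, if_pos hx, if_pos hxw]
      by_cases hle : x ≤ w
      · rw [Set.indicator_of_mem (show x ∈ Set.Ioc 0 w from ⟨hx, hle⟩)]
        refine le_add_of_le_of_nonneg (ENNReal.ofReal_le_ofReal ?_) zero_le
        gcongr ?_ * ?_
        exact Real.rpow_le_rpow_of_nonpos hw (by linarith) (by linarith)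
      · rw [Set.indicator_of_mem (show x ∈ Set.Ioi w from not_le.1 hle)]
        refine le_add_of_nonneg_of_le zero_le (ENNReal.ofReal_le_ofReal ?_)
        have : x ^ (H - 2) = x ^ (H / 2 - 1) * x ^ (H / 2 - 1) := by
          rw [← Real.rpow_add hx]; ring_nf
        rw [this]
        gcongr ?_ * ?_
        exact Real.rpow_le_rpow_of_nonpos hx (by linarith) (by linarith)
    · simp [rosPow, hx]
  refine (lintegral_mono hsub).trans ?_
  rw [lintegral_add_left (Measurable.indicator (by fun_prop) measurableSet_Ioc),
    lintegral_indicator measurableSet_Ioc, lintegral_indicator measurableSet_Ioi,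
    ← ofReal_integral_eq_lintegral_ofReal, ← ofReal_integral_eq_lintegral_ofReal,
    ← ENNReal.ofReal_add]
  · apply le_of_eq
    congr 1
    rw [integral_mul_const, ← intervalIntegral.integral_of_le hw.le,
      integral_rpow (Or.inl (by linarith)), integral_Ioi_rpow_of_lt (by linarith) hw,
      Real.zero_rpow (by linarith), add_mul]
    have e1 : w ^ (H - 1) = w ^ (H / 2 - 1 + 1) * w ^ (H / 2 - 1) := by
      rw [← Real.rpow_add hw]; ring_nf
    have e2 : H - 2 + 1 = -(1 - H) := by ring
    have e3 : w ^ (-(1 - H)) = w ^ (H - 1) := by ring_nf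
    rw [e2, e3, e1]
    have : (1 - H) ≠ 0 := by linarith
    have : H / 2 - 1 + 1 ≠ 0 := by linarith
    have e4 : H / 2 - 1 + 1 = H / 2 := by ring
    rw [e4] at *
    field_simp
    ring
  · exact setIntegral_nonneg measurableSet_Ioc fun x hx => by
      have := hx.1; positivity
  · exact setIntegral_nonneg measurableSet_Ioi fun x hx => by
      have := hw.trans hx; positivity
  · exact integrableOn_Ioi_rpow_of_lt (by linarith) hw
  · exact (ae_restrict_mem measurableSet_Ioi).mono fun x hx => by
      have := hw.trans hx; simp only [Pi.zero_apply]; positivity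
  · refine Integrable.mul_const ?_ _
    exact (intervalIntegrable_iff_integrableOn_Ioc_of_le hw.le).1
      (intervalIntegral.intervalIntegrable_rpow' (by linarith))
  · exact (ae_restrict_mem measurableSet_Ioc).mono fun x hx => by
      have := hx.1; simp only [Pi.zero_apply]; positivity

lemma lintegral_rosPow_sub_mul_rosPow_sub_le {H : ℝ} (hH : H ∈ Set.Ioo (1 / 2 : ℝ) 1) {u v : ℝ}
    (huv : u ≠ v) :
    ∫⁻ y, ENNReal.ofReal (rosPow H (u - y)) * ENNReal.ofReal (rosPow H (v - y)) ≤
      ENNReal.ofReal ((1 / (H / 2) + 1 / (1 - H)) * |u - v| ^ (H - 1)) := by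
  wlog h : u < v generalizing u v
  · have := this huv.symm (lt_of_le_of_ne (not_lt.1 h) huv.symm)
    rw [abs_sub_comm]
    simpa only [mul_comm] using this
  have := lintegral_rosPow_mul_rosPow_add_le hH (sub_pos.2 h)
  rw [abs_sub_comm, abs_of_pos (sub_pos.2 h)]
  rw [← lintegral_sub_left_eq_self _ u] at this
  have e : ∀ y, u - y + (v - u) = v - y := fun y => by ring
  simpa only [e] using this

lemma setLIntegral_abs_sub_rpow_le {b T u : ℝ} (hu : u ∈ Set.Icc 0 T) :
    ∫⁻ v in Set.Icc 0 T, ENNReal.ofReal (|u - v| ^ b) ≤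
      ∫⁻ z in Set.Icc (-T) T, ENNReal.ofReal (|z| ^ b) := by
  rw [← lintegral_indicator measurableSet_Icc, ← lintegral_indicator measurableSet_Icc,
    ← lintegral_sub_left_eq_self ((Set.Icc (-T) T).indicator _) u]
  refine lintegral_mono fun v => ?_
  by_cases hv : v ∈ Set.Icc 0 T
  · rw [Set.indicator_of_mem hv, Set.indicator_of_mem]
    exact ⟨by linarith [hv.2, hu.1], by linarith [hv.1, hu.2]⟩
  · simp [hv]

lemma setLIntegral_abs_rpow_lt_top {b : ℝ} (hb : -1 < b) (T : ℝ) :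
    ∫⁻ z in Set.Icc (-T) T, ENNReal.ofReal (|z| ^ b) < ⊤ := by
  have hpos : IntervalIntegrable (fun z : ℝ => |z| ^ b) volume 0 |T| := by
    refine (intervalIntegral.intervalIntegrable_rpow' hb).congr fun z hz => ?_
    rw [Set.uIoc_of_le (abs_nonneg T)] at hz
    simp only [abs_of_pos hz.1]
  have hneg : IntervalIntegrable (fun z : ℝ => |z| ^ b) volume (-|T|) 0 := by
    have := hpos.comp_sub_left 0
    simpa using this.symm
  have hint : IntegrableOn (fun z : ℝ => |z| ^ b) (Set.Icc (-|T|) |T|) := by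
    rw [integrableOn_Icc_iff_integrableOn_Ioc,
      ← intervalIntegrable_iff_integrableOn_Ioc_of_le (by linarith [abs_nonneg T])]
    exact hneg.trans hpos
  exact (hint.mono_set (Set.Icc_subset_Icc (neg_le_neg (le_abs_self T))
    (le_abs_self T))).lintegral_lt_top

lemma lintegral_sq_lintegral_mul {F : ℝ → ℝ → ENNReal} (hF : Measurable (Function.uncurry F))
    (μ : Measure ℝ) [SFinite μ] :
    ∫⁻ y : ℝ × ℝ, (∫⁻ u, F u y.1 * F u y.2 ∂μ) ^ 2 =
      ∫⁻ u, ∫⁻ v, (∫⁻ y, F u y * F v y) ^ 2 ∂μ ∂μ := by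
  have hF' : ∀ {α : Type} [MeasurableSpace α] {f g : α → ℝ}, Measurable f → Measurable g →
      Measurable fun x => F (f x) (g x) := fun hf hg => hF.comp (hf.prodMk hg)
  have hsq : ∀ y : ℝ × ℝ, (∫⁻ u, F u y.1 * F u y.2 ∂μ) ^ 2 =
      ∫⁻ u, ∫⁻ v, (F u y.1 * F v y.1) * (F u y.2 * F v y.2) ∂μ ∂μ := by
    intro y
    have hm : Measurable fun u => F u y.1 * F u y.2 :=
      (hF' measurable_id measurable_const).mul (hF' measurable_id measurable_const)
    rw [sq, ← lintegral_mul_const _ hm]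
    refine lintegral_congr fun u => ?_
    rw [← lintegral_const_mul _ hm]
    exact lintegral_congr fun v => mul_mul_mul_comm _ _ _ _
  have hm : Measurable fun q : ((ℝ × ℝ) × ℝ) × ℝ =>
      (F q.1.2 q.1.1.1 * F q.2 q.1.1.1) * (F q.1.2 q.1.1.2 * F q.2 q.1.1.2) := by
    refine ((hF' ?_ ?_).mul (hF' ?_ ?_)).mul ((hF' ?_ ?_).mul (hF' ?_ ?_)) <;> fun_prop
  rw [lintegral_congr hsq, lintegral_lintegral_swap
    (hm.lintegral_prod_right' (ν := μ)).aemeasurable]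
  refine lintegral_congr fun u => ?_
  have hmu : Measurable fun q : (ℝ × ℝ) × ℝ => ((q.1, u), q.2) := by fun_prop
  refine (lintegral_lintegral_swap ?_).trans (lintegral_congr fun v => ?_)
  · exact (hm.comp hmu).aemeasurable
  have hmuv : AEMeasurable (fun y => F u y * F v y) volume :=
    ((hF' measurable_const measurable_id).mul (hF' measurable_const measurable_id)).aemeasurable
  rw [sq, ← lintegral_prod_mul hmuv hmuv]
  rfl

/-- The `[0, ∞]`-valued version of the Rosenblatt kernel is square integrable. -/
lemma lintegral_sq_setLIntegral_rosPow_lt_top {H : ℝ} (hH : H ∈ Set.Ioo (1 / 2 : ℝ) 1) (T : ℝ) :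
    ∫⁻ y : ℝ × ℝ, (∫⁻ u in Set.Icc 0 T,
      ENNReal.ofReal (rosPow H (u - y.1) * rosPow H (u - y.2))) ^ 2 < ⊤ := by
  simp_rw [ENNReal.ofReal_mul (rosPow_nonneg H _)]
  rw [lintegral_sq_lintegral_mul (F := fun u y => ENNReal.ofReal (rosPow H (u - y)))
    (by simp only [Function.uncurry_def]; fun_prop)]
  set K : ℝ := 1 / (H / 2) + 1 / (1 - H)
  have hK0 : 0 ≤ K := by
    have h1 := hH.1
    have h2 := sub_pos.2 hH.2
    positivity
  have hb : -1 < 2 * (H - 1) := by linarith [hH.1]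
  have hbound : ∀ u ∈ Set.Icc 0 T, ∫⁻ v in Set.Icc 0 T, (∫⁻ y, ENNReal.ofReal (rosPow H (u - y)) *
      ENNReal.ofReal (rosPow H (v - y))) ^ 2 ≤
      ENNReal.ofReal (K ^ 2) * ∫⁻ z in Set.Icc (-T) T, ENNReal.ofReal (|z| ^ (2 * (H - 1))) := by
    intro u hu
    refine le_trans ?_ (mul_le_mul_right (setLIntegral_abs_sub_rpow_le hu) _)
    rw [← lintegral_const_mul _ (by fun_prop)]
    refine lintegral_mono_ae (ae_restrict_of_ae ?_)
    filter_upwards [compl_mem_ae_iff.2 (measure_singleton u)] with v hv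
    have huv : u ≠ v := fun h => hv h.symm
    calc _ ≤ (ENNReal.ofReal (K * |u - v| ^ (H - 1))) ^ 2 := by
          gcongr
          exact lintegral_rosPow_sub_mul_rosPow_sub_le hH huv
      _ = _ := by
          rw [← ENNReal.ofReal_pow (by positivity), ← ENNReal.ofReal_mul (by positivity), mul_pow,
            ← Real.rpow_mul_natCast (abs_nonneg _)]
          push_cast
          rw [mul_comm (H - 1)]
  refine (setLIntegral_mono measurable_const hbound).trans_lt ?_
  rw [setLIntegral_const]
  exact ENNReal.mul_lt_top (ENNReal.mul_lt_top ENNReal.ofReal_lt_top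
    (setLIntegral_abs_rpow_lt_top hb T)) measure_Icc_lt_top

lemma ae_intervalIntegrable_rosPow {H : ℝ} (hH : H ∈ Set.Ioo (1 / 2 : ℝ) 1) {T : ℝ} (hT : 0 ≤ T) :
    ∀ᵐ y : ℝ × ℝ,
      IntervalIntegrable (fun u => rosPow H (u - y.1) * rosPow H (u - y.2)) volume 0 T := by
  have hm : Measurable fun q : (ℝ × ℝ) × ℝ =>
      ENNReal.ofReal (rosPow H (q.2 - q.1.1) * rosPow H (q.2 - q.1.2)) := by fun_prop
  filter_upwards [ae_lt_top ((hm.lintegral_prod_right'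
    (ν := volume.restrict (Set.Icc 0 T))).pow_const 2)
    (lintegral_sq_setLIntegral_rosPow_lt_top hH T).ne] with y hy
  rw [intervalIntegrable_iff_integrableOn_Icc_of_le hT]
  refine ⟨Measurable.aestronglyMeasurable (by fun_prop), ?_⟩
  rw [hasFiniteIntegral_iff_ofReal
    (.of_forall fun u => mul_nonneg (rosPow_nonneg _ _) (rosPow_nonneg _ _))]
  exact (ENNReal.pow_lt_top_iff.1 hy).resolve_right two_ne_zero

lemma memLp_two_rosKernel {H : ℝ} (hH : H ∈ Set.Ioo (1 / 2 : ℝ) 1) {T : ℝ} (hT : 0 ≤ T) :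
    MemLp (fun y : ℝ × ℝ => rosKernel H T y.1 y.2) 2 := by
  have hm : Measurable fun q : (ℝ × ℝ) × ℝ =>
      rosPow H (q.2 - q.1.1) * rosPow H (q.2 - q.1.2) := by fun_prop
  have hmeas : AEStronglyMeasurable (fun y : ℝ × ℝ => rosKernel H T y.1 y.2) := by
    simp_rw [rosKernel_eq, intervalIntegral.integral_of_le hT]
    exact (hm.stronglyMeasurable.integral_prod_right'
      (ν := volume.restrict (Set.Ioc 0 T))).aestronglyMeasurable
  rw [memLp_two_iff_integrable_sq hmeas]
  refine ⟨hmeas.pow 2, ?_⟩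
  rw [hasFiniteIntegral_iff_ofReal (.of_forall fun y => sq_nonneg _)]
  refine lt_of_le_of_lt (lintegral_mono fun y => ?_) (lintegral_sq_setLIntegral_rosPow_lt_top hH T)
  have hnn : ∀ u, 0 ≤ rosPow H (u - y.1) * rosPow H (u - y.2) :=
    fun u => mul_nonneg (rosPow_nonneg _ _) (rosPow_nonneg _ _)
  rw [rosKernel_eq, intervalIntegral.integral_of_le hT, ← integral_Icc_eq_integral_Ioc,
    ENNReal.ofReal_pow (integral_nonneg hnn)]
  gcongr
  rw [integral_eq_lintegral_of_nonneg_ae (.of_forall hnn)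
    (Measurable.aestronglyMeasurable (by fun_prop))]
  exact ENNReal.ofReal_toReal_le

lemma rosKernel_mul (H : ℝ) {t : ℝ} (ht : 0 < t) (y₁ y₂ : ℝ) :
    rosKernel H t (t * y₁) (t * y₂) = t ^ (H - 1) * rosKernel H 1 y₁ y₂ := by
  have h := intervalIntegral.smul_integral_comp_mul_left (a := 0) (b := 1)
    (fun u => rosPow H (u - t * y₁) * rosPow H (u - t * y₂)) t
  rw [mul_zero, mul_one] at h
  rw [rosKernel_eq, rosKernel_eq, ← h, smul_eq_mul, ← intervalIntegral.integral_const_mul,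
    ← intervalIntegral.integral_const_mul]
  refine intervalIntegral.integral_congr fun u _ => ?_
  have e : t ^ (H - 1) = t * (t ^ (H / 2 - 1) * t ^ (H / 2 - 1)) := by
    rw [← Real.rpow_add ht, mul_comm, ← Real.rpow_add_one ht.ne']
    ring_nf
  simp only [← mul_sub, rosPow_mul H ht, e]
  ring

lemma integral_rosKernel_sq {H : ℝ} (hH : 0 < H) {t : ℝ} (ht : 0 ≤ t) :
    ∫ y : ℝ × ℝ, rosKernel H t y.1 y.2 ^ 2 =
      t ^ (2 * H) * ∫ y : ℝ × ℝ, rosKernel H 1 y.1 y.2 ^ 2 := by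
  rcases ht.eq_or_lt with rfl | ht
  · simp [rosKernel_eq, Real.zero_rpow (show 2 * H ≠ 0 by positivity)]
  have h := Measure.integral_comp_smul (volume : Measure (ℝ × ℝ))
    (fun y => rosKernel H t y.1 y.2 ^ 2) t
  simp only [Prod.smul_fst, Prod.smul_snd, smul_eq_mul, rosKernel_mul H ht, mul_pow,
    integral_const_mul, Module.finrank_prod, Module.finrank_self] at h
  rw [abs_of_pos (by positivity), eq_inv_mul_iff_mul_eq₀ (by positivity)] at h
  rw [← h, ← mul_assoc, ← Real.rpow_mul_natCast ht.le, ← Real.rpow_natCast, ← Real.rpow_add ht]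
  congr 2
  push_cast
  ring

lemma integral_rosKernel_sub_sq {H : ℝ} (hH : H ∈ Set.Ioo (1 / 2 : ℝ) 1) {s t : ℝ} (hs : 0 ≤ s)
    (ht : 0 ≤ t) :
    ∫ y : ℝ × ℝ, (rosKernel H t y.1 y.2 - rosKernel H s y.1 y.2) ^ 2 =
      ∫ y : ℝ × ℝ, rosKernel H (t - s) y.1 y.2 ^ 2 := by
  rw [← integral_sub_right_eq_self (fun y : ℝ × ℝ => rosKernel H (t - s) y.1 y.2 ^ 2) (s, s)]
  refine integral_congr_ae ?_
  filter_upwards [ae_intervalIntegrable_rosPow hH hs, ae_intervalIntegrable_rosPow hH ht]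
    with y hys hyt
  have h := intervalIntegral.integral_comp_add_right (a := 0) (b := t - s)
    (fun u => rosPow H (u - y.1) * rosPow H (u - y.2)) s
  rw [zero_add, sub_add_cancel] at h
  rw [rosKernel_eq, rosKernel_eq, rosKernel_eq,
    intervalIntegral.integral_interval_sub_left hyt hys, ← h]
  simp only [Prod.fst_sub, Prod.snd_sub, sub_sub_eq_add_sub]

/-- **Fractional-Brownian-motion covariance structure of the Rosenblatt kernels.**
For `H ∈ (1/2, 1)` and `0 ≤ s ≤ t`,
`∫_{ℝ²} L̃_t L̃_s = (1/2)(t^{2H} + s^{2H} − (t−s)^{2H}) ∫_{ℝ²} L̃_1²`. -/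
theorem integral_rosKernel_mul_rosKernel
    (H : ℝ) (hH : H ∈ Set.Ioo (1 / 2 : ℝ) 1) (s t : ℝ) (hs : 0 ≤ s) (hst : s ≤ t) :
    ∫ y : ℝ × ℝ, rosKernel H t y.1 y.2 * rosKernel H s y.1 y.2 =
      1 / 2 * (t ^ (2 * H) + s ^ (2 * H) - (t - s) ^ (2 * H)) *
        ∫ y : ℝ × ℝ, (rosKernel H 1 y.1 y.2) ^ 2 := by
  have ht := hs.trans hst
  have hH0 : 0 < H := by linarith [hH.1]
  have hLt := memLp_two_rosKernel hH ht
  have hLs := memLp_two_rosKernel hH hs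
  have key : ∀ y : ℝ × ℝ, rosKernel H t y.1 y.2 * rosKernel H s y.1 y.2 =
      1 / 2 * (rosKernel H t y.1 y.2 ^ 2 + rosKernel H s y.1 y.2 ^ 2 -
        (rosKernel H t y.1 y.2 - rosKernel H s y.1 y.2) ^ 2) := fun y => by ring
  have h₁ := integral_sub (hLt.integrable_sq.add hLs.integrable_sq) (hLt.sub hLs).integrable_sq
  simp only [Pi.add_apply, Pi.sub_apply] at h₁
  simp_rw [key]
  rw [integral_const_mul, h₁, integral_add hLt.integrable_sq hLs.integrable_sq,
    integral_rosKernel_sub_sq hH hs ht, integral_rosKernel_sq hH0 ht, integral_rosKernel_sq hH0 hs,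
    integral_rosKernel_sq hH0 (sub_nonneg.2 hst)]
  ring
end
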